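/- Fix integers p ≥ 1 and 1 ≤ k ≤ p and t ∈ (0,1). Then ∫_{ℝ^p} e_k(x_1²,…,x_p²) · f(t;x) dx = (2p+1)! / ( (2p+1−2k)! · 2^k · k! ) · (t(1−t))^k, where e_k denotes the k-th elementary symmetric polynomial in p variables. -/

import Mathlib

open MeasureTheory

/-- The normalizing constant `c_p` (indices `i < j` here are 0-indexed, so the
paper's `(j−i)(j+i−1)` becomes `(j−i)(j+i+1)`). -/
noncomputable def cW (p : ℕ) : ℝ :=
  2 ^ ((3 * (p : ℝ)) / 2) * (Nat.factorial p : ℝ) /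
    ((Nat.factorial (2 * p) : ℝ) * Real.pi ^ ((p : ℝ) / 2) *
      ∏ i : Fin p, ∏ j ∈ Finset.Ioi i, ((((j : ℕ) : ℝ) - ((i : ℕ) : ℝ)) *
        (((j : ℕ) : ℝ) + ((i : ℕ) : ℝ) + 1)))

open Classical in
/-- The density `f(t;x)` of the continuous `p`-watermelon with wall condition
at time `t`. -/
noncomputable def fW (p : ℕ) (t : ℝ) (x : Fin p → ℝ) : ℝ :=
  if (∀ i, 0 ≤ x i) ∧ (∀ i j : Fin p, i ≤ j → x i ≤ x j) then
    cW p * (t * (1 - t)) ^ (-(((p : ℝ) ^ 2) + (p : ℝ) / 2)) *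
      (∏ i : Fin p, ∏ j ∈ Finset.Ioi i, ((x j) ^ 2 - (x i) ^ 2) ^ 2) *
      (∏ i : Fin p, (x i) ^ 2) *
      Real.exp (-(∑ i, (x i) ^ 2) / (2 * t * (1 - t)))
  else 0

open Polynomial in
/-- The probabilists' Hermite polynomial with real coefficients. -/
noncomputable def realHermite (n : ℕ) : ℝ[X] := (hermite n).map (Int.castRingHom ℝ)

open Polynomial in
lemma integrable_polynomial_mul_gaussian (q : ℝ[X]) :
    Integrable fun x : ℝ => q.eval x * Real.exp (-x ^ 2 / 2) := by
  induction q using Polynomial.induction_on' with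
  | add p q hp hq => exact (hp.add hq).congr (Filter.Eventually.of_forall fun x => by simp [add_mul])
  | monomial n a =>
    have h := integrable_rpow_mul_exp_neg_mul_sq (b := 1 / 2) (by norm_num) (s := n)
      (by linarith [n.cast_nonneg (α := ℝ)])
    refine (h.const_mul a).congr (Filter.Eventually.of_forall fun x => ?_)
    simp only [eval_monomial, Real.rpow_natCast, mul_assoc]
    rw [show -(1 / 2) * x ^ 2 = -x ^ 2 / 2 by ring]

open Polynomial in
lemma integral_polynomial_mul_hermite_succ (q : ℝ[X]) (n : ℕ) :
    ∫ x : ℝ, (q * realHermite (n + 1)).eval x * Real.exp (-x ^ 2 / 2) =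
      ∫ x : ℝ, (derivative q * realHermite n).eval x * Real.exp (-x ^ 2 / 2) := by
  have hsucc : realHermite (n + 1) = X * realHermite n - derivative (realHermite n) := by
    simp [realHermite, hermite_succ, Polynomial.map_sub, derivative_map]
  have hd : ∀ x : ℝ, HasDerivAt
      (fun x : ℝ => (q * realHermite n).eval x * Real.exp (-x ^ 2 / 2))
      ((derivative q * realHermite n).eval x * Real.exp (-x ^ 2 / 2) -
        (q * realHermite (n + 1)).eval x * Real.exp (-x ^ 2 / 2)) x := by
    intro x
    have hg : HasDerivAt (fun x : ℝ => Real.exp (-x ^ 2 / 2)) (Real.exp (-x ^ 2 / 2) * -x) x := by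
      have h : HasDerivAt (fun x : ℝ => -x ^ 2 / 2) (-x) x := by
        convert! ((hasDerivAt_pow 2 x).neg.div_const 2) using 1
        ring
      exact h.exp
    convert! ((q * realHermite n).hasDerivAt x).mul hg using 1
    simp only [hsucc, derivative_mul, eval_mul, eval_add, eval_sub, eval_X]
    ring
  have h0 := integral_eq_zero_of_hasDerivAt_of_integrable hd
    ((integrable_polynomial_mul_gaussian _).sub (integrable_polynomial_mul_gaussian _))
    (integrable_polynomial_mul_gaussian _)
  rw [integral_sub (integrable_polynomial_mul_gaussian _)
    (integrable_polynomial_mul_gaussian _)] at h0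
  linarith

open Polynomial in
lemma integral_polynomial_mul_hermite (q : ℝ[X]) (n : ℕ) :
    ∫ x : ℝ, (q * realHermite n).eval x * Real.exp (-x ^ 2 / 2) =
      ∫ x : ℝ, (derivative^[n] q).eval x * Real.exp (-x ^ 2 / 2) := by
  induction n generalizing q with
  | zero => simp [realHermite]
  | succ n ih => rw [integral_polynomial_mul_hermite_succ, ih, Function.iterate_succ_apply]

open Polynomial in
lemma integral_hermite_mul_hermite {m n : ℕ} (h : m ≤ n) :
    ∫ x : ℝ, (realHermite m * realHermite n).eval x * Real.exp (-x ^ 2 / 2) =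
      if m = n then (n.factorial : ℝ) * √(2 * Real.pi) else 0 := by
  have hder : derivative^[n] (realHermite m) =
      C (if m = n then (n.factorial : ℝ) else 0) := by
    ext i
    rw [coeff_iterate_derivative, coeff_C]
    rcases h.eq_or_lt with rfl | hlt
    · rcases Nat.eq_zero_or_pos i with rfl | hi
      · simp [realHermite, Nat.descFactorial_self]
      · simp [realHermite, coeff_hermite_of_lt (show m < i + m by omega), hi.ne']
    · simp [realHermite, coeff_hermite_of_lt (show m < i + n by omega), hlt.ne]
  rw [integral_polynomial_mul_hermite, hder]
  simp only [eval_C]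
  rw [integral_const_mul]
  have hg : ∫ x : ℝ, Real.exp (-x ^ 2 / 2) = √(2 * Real.pi) := by
    rw [show 2 * Real.pi = Real.pi / (1 / 2) by ring, ← integral_gaussian]
    congr 1 with x
    ring_nf
  rw [hg]
  split_ifs <;> simp

/-- The Gaussian weight cut off to the nonnegative half-line. -/
noncomputable def halfGaussian (x : ℝ) : ℝ := if 0 ≤ x then Real.exp (-x ^ 2 / 2) else 0

open Polynomial in
lemma integrable_polynomial_mul_halfGaussian (q : ℝ[X]) :
    Integrable fun x : ℝ => q.eval x * halfGaussian x := by
  refine ((integrable_polynomial_mul_gaussian q).indicator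
    (measurableSet_Ici (a := (0 : ℝ)))).congr (Filter.Eventually.of_forall fun x => ?_)
  simp [halfGaussian, Set.indicator]

lemma integral_even_mul_halfGaussian (f : ℝ → ℝ) (hf : ∀ x, f |x| = f x) :
    ∫ x : ℝ, f x * halfGaussian x = (∫ x : ℝ, f x * Real.exp (-x ^ 2 / 2)) / 2 := by
  have h := integral_comp_abs (f := fun x => f x * Real.exp (-x ^ 2 / 2))
  simp only [hf, sq_abs] at h
  rw [h, ← integral_Ici_eq_integral_Ioi, ← integral_indicator measurableSet_Ici,
    mul_div_cancel_left₀ _ two_ne_zero]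
  congr 1 with x
  simp [halfGaussian, Set.indicator]

open Polynomial in
/-- The polynomial `Q` with `x * Q (x ^ 2) = He_{2 j + 1} (x)`: a monic Laguerre polynomial of
parameter `1 / 2`, rescaled. -/
noncomputable def oddHermite (j : ℕ) : ℝ[X] :=
  ∑ i ∈ Finset.range (j + 1), C ((hermite (2 * j + 1)).coeff (2 * i + 1) : ℝ) * X ^ i

open Polynomial in
lemma coeff_oddHermite (j i : ℕ) :
    (oddHermite j).coeff i = ((hermite (2 * j + 1)).coeff (2 * i + 1) : ℝ) := by
  simp only [oddHermite, finsetSum_coeff, coeff_C_mul, coeff_X_pow, mul_ite, mul_one, mul_zero,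
    Finset.sum_ite_eq, Finset.mem_range]
  split_ifs with h
  · rfl
  · rw [coeff_hermite_of_lt (by omega), Int.cast_zero]

open Polynomial in
lemma oddHermite_monic_natDegree (j : ℕ) :
    (oddHermite j).Monic ∧ (oddHermite j).natDegree = j := by
  have h1 : (oddHermite j).coeff j = 1 := by rw [coeff_oddHermite, coeff_hermite_self]; simp
  have h2 : (oddHermite j).natDegree ≤ j := by
    rw [natDegree_le_iff_coeff_eq_zero]
    intro i hi
    rw [coeff_oddHermite, coeff_hermite_of_lt (by omega), Int.cast_zero]
  exact ⟨monic_of_natDegree_le_of_coeff_eq_one j h2 h1,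
    natDegree_eq_of_le_of_coeff_ne_zero h2 (by rw [h1]; exact one_ne_zero)⟩

open Polynomial in
lemma mul_eval_sq_oddHermite (j : ℕ) (x : ℝ) :
    x * (oddHermite j).eval (x ^ 2) = (realHermite (2 * j + 1)).eval x := by
  have hsplit : ∀ (f : ℕ → ℝ) (n : ℕ), ∑ i ∈ Finset.range (2 * n), f i =
      ∑ i ∈ Finset.range n, (f (2 * i) + f (2 * i + 1)) := by
    intro f n
    induction n with
    | zero => simp
    | succ n ih =>
      rw [show 2 * (n + 1) = 2 * n + 1 + 1 by ring, Finset.sum_range_succ, Finset.sum_range_succ,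
        Finset.sum_range_succ, ih, add_assoc]
  rw [eval_eq_sum_range' (p := realHermite (2 * j + 1)) (n := 2 * (j + 1)), hsplit, oddHermite, eval_finsetSum, Finset.mul_sum]
  · refine Finset.sum_congr rfl fun i _ => ?_
    simp only [realHermite, coeff_map,
      coeff_hermite_of_odd_add (show Odd (2 * j + 1 + 2 * i) from ⟨j + i, by ring⟩),
      eval_mul, eval_C, eval_pow, eval_X, map_zero, zero_mul, zero_add, eq_intCast]
    ring
  · refine lt_of_le_of_lt natDegree_map_le ?_
    rw [natDegree_hermite]
    omega

open Polynomial in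
lemma integral_oddHermite_mul_oddHermite (i j : ℕ) :
    ∫ x : ℝ, ((oddHermite i).eval (x ^ 2) * (oddHermite j).eval (x ^ 2)) *
        (x ^ 2 * halfGaussian x) =
      if i = j then ((2 * j + 1).factorial : ℝ) * √(2 * Real.pi) / 2 else 0 := by
  wlog h : i ≤ j generalizing i j
  · have := this j i (by omega)
    simp only [mul_comm ((oddHermite i).eval _), this]
    split_ifs <;> first | rfl | omega
  have h1 := integral_even_mul_halfGaussian
    (fun x => ((oddHermite i).eval (x ^ 2) * (oddHermite j).eval (x ^ 2)) * x ^ 2) (by simp)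
  simp only [mul_assoc] at h1 ⊢
  rw [h1]
  have h2 := integral_hermite_mul_hermite (show 2 * i + 1 ≤ 2 * j + 1 by omega)
  simp only [eval_mul, ← mul_eval_sq_oddHermite] at h2
  rw [show (∫ x : ℝ, (oddHermite i).eval (x ^ 2) * ((oddHermite j).eval (x ^ 2) *
      (x ^ 2 * Real.exp (-x ^ 2 / 2)))) = ∫ x : ℝ, x * (oddHermite i).eval (x ^ 2) *
      (x * (oddHermite j).eval (x ^ 2)) * Real.exp (-x ^ 2 / 2) by congr 1 with x; ring, h2]
  split_ifs <;> first | rfl | omega | simp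

/-- The Andréief identity. -/
lemma integral_det_mul_det {p : ℕ} (a b : Fin p → ℝ → ℝ) (w : ℝ → ℝ)
    (h_integrable : ∀ i j, Integrable fun x => a i x * b j x * w x) :
    (Integrable fun x : Fin p → ℝ => (Matrix.of fun i j => a i (x j)).det *
      (Matrix.of fun i j => b i (x j)).det * ∏ i, w (x i)) ∧
    ∫ x : Fin p → ℝ, (Matrix.of fun i j => a i (x j)).det * (Matrix.of fun i j => b i (x j)).det *
        ∏ i, w (x i) =
      p.factorial * (Matrix.of fun i j => ∫ x, a i x * b j x * w x).det := by
  have hexp : ∀ x : Fin p → ℝ,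
      (Matrix.of fun i j => a i (x j)).det * (Matrix.of fun i j => b i (x j)).det *
        ∏ i, w (x i) =
      ∑ τ : Equiv.Perm (Fin p), ∑ σ : Equiv.Perm (Fin p),
        ((Equiv.Perm.sign σ : ℤ) : ℝ) * ((Equiv.Perm.sign τ : ℤ) : ℝ) *
          ∏ i, (a (σ i) (x i) * b (τ i) (x i) * w (x i)) := by
    intro x
    simp only [Matrix.det_apply', Matrix.of_apply, Finset.sum_mul, Finset.mul_sum,
      Finset.prod_mul_distrib]
    refine Finset.sum_congr rfl fun τ _ => Finset.sum_congr rfl fun σ _ => ?_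
    ring
  have hi : ∀ σ τ : Equiv.Perm (Fin p), Integrable fun x : Fin p → ℝ =>
      ((Equiv.Perm.sign σ : ℤ) : ℝ) * ((Equiv.Perm.sign τ : ℤ) : ℝ) *
          ∏ i, (a (σ i) (x i) * b (τ i) (x i) * w (x i)) := fun σ τ =>
    (Integrable.fintype_prod (f := fun i y => a (σ i) y * b (τ i) y * w y)
      fun i => h_integrable (σ i) (τ i)).const_mul _
  simp only [hexp]
  refine ⟨integrable_finsetSum _ fun τ _ => integrable_finsetSum _ fun σ _ => hi σ τ, ?_⟩
  rw [integral_finsetSum _ fun τ _ => integrable_finsetSum _ fun σ _ => hi σ τ]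
  have hτ : ∀ τ : Equiv.Perm (Fin p),
      ∫ x : Fin p → ℝ, ∑ σ : Equiv.Perm (Fin p),
        ((Equiv.Perm.sign σ : ℤ) : ℝ) * ((Equiv.Perm.sign τ : ℤ) : ℝ) *
          ∏ i, (a (σ i) (x i) * b (τ i) (x i) * w (x i)) =
      (Matrix.of fun i j => ∫ x, a i x * b j x * w x).det := by
    intro τ
    rw [integral_finsetSum _ fun σ _ => hi σ τ, Matrix.det_apply']
    simp only [integral_const_mul]
    rw [← Equiv.sum_comp (Equiv.mulRight τ)]
    refine Finset.sum_congr rfl fun σ _ => ?_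
    rw [integral_fintype_prod_volume_eq_prod
      (f := fun i y => a ((Equiv.mulRight τ σ) i) y * b (τ i) y * w y)]
    simp only [Equiv.coe_mulRight, Equiv.Perm.sign_mul, Equiv.Perm.mul_apply, Matrix.of_apply,
      Units.val_mul, Int.cast_mul]
    rw [Equiv.prod_comp τ (fun i => ∫ y, a (σ i) y * b i y * w y)]
    congr 1
    have hsq : ((Equiv.Perm.sign τ : ℤ) : ℝ) * ((Equiv.Perm.sign τ : ℤ) : ℝ) = 1 := by
      rw [← Int.cast_mul, Int.units_coe_mul_self, Int.cast_one]
    rw [mul_assoc, hsq, mul_one]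
  simp only [hτ, Finset.sum_const, Finset.card_univ, Fintype.card_perm, Fintype.card_fin,
    nsmul_eq_mul]

open Classical in
lemma factorial_mul_integral_monotone {p : ℕ} (G : (Fin p → ℝ) → ℝ) (hG : Integrable G)
    (hsymm : ∀ (σ : Equiv.Perm (Fin p)) (x : Fin p → ℝ), G (x ∘ σ) = G x)
    (h0 : ∀ x, ¬ Function.Injective x → G x = 0) :
    p.factorial * ∫ x, (if Monotone x then G x else 0) = ∫ x, G x := by
  have hmeas : MeasurableSet {x : Fin p → ℝ | Monotone x} := by
    have : {x : Fin p → ℝ | Monotone x} = ⋂ i, ⋂ j, {x | i ≤ j → x i ≤ x j} := by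
      ext x
      simp [Monotone]
    rw [this]
    refine MeasurableSet.iInter fun i => MeasurableSet.iInter fun j => ?_
    by_cases h : i ≤ j
    · simpa [h] using measurableSet_le (measurable_pi_apply i) (measurable_pi_apply j)
    · simp [h]
  have hF : Integrable fun x => if Monotone x then G x else 0 :=
    (hG.indicator hmeas).congr (Filter.Eventually.of_forall fun x => by simp [Set.indicator])
  have hmp : ∀ σ : Equiv.Perm (Fin p), MeasurePreserving
      (MeasurableEquiv.piCongrLeft (fun _ : Fin p => ℝ) σ.symm) volume volume := fun σ =>
    volume_measurePreserving_piCongrLeft _ _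
  have hap : ∀ (σ : Equiv.Perm (Fin p)) (x : Fin p → ℝ),
      MeasurableEquiv.piCongrLeft (fun _ : Fin p => ℝ) σ.symm x = x ∘ σ := by
    intro σ x
    ext i
    simp [MeasurableEquiv.coe_piCongrLeft, Equiv.piCongrLeft_apply]
  have hpt : ∀ x, G x = ∑ σ : Equiv.Perm (Fin p), if Monotone (x ∘ σ) then G (x ∘ σ) else 0 := by
    intro x
    simp only [hsymm]
    by_cases hx : Function.Injective x
    · rw [Finset.sum_eq_single (Tuple.sort x), if_pos (Tuple.monotone_sort x)]
      · intro σ _ hσ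
        refine if_neg fun hm => hσ ?_
        rw [← Tuple.comp_sort_eq_comp_iff_monotone] at hm
        exact Equiv.ext fun i => hx (congrFun hm i)
      · simp
    · simp [h0 x hx]
  have hcomp : ∀ σ : Equiv.Perm (Fin p),
      ∫ x : Fin p → ℝ, (if Monotone (x ∘ σ) then G (x ∘ σ) else 0) =
        ∫ x, (if Monotone x then G x else 0) := by
    intro σ
    have h := (hmp σ).integral_comp' (fun x => if Monotone x then G x else 0)
    simpa only [hap] using h
  have h_integrable : ∀ σ : Equiv.Perm (Fin p),
      Integrable fun x : Fin p → ℝ => if Monotone (x ∘ σ) then G (x ∘ σ) else 0 := by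
    intro σ
    have := (hmp σ).integrable_comp_of_integrable hF
    simpa only [Function.comp_def, hap] using this
  conv_rhs => rw [integral_congr_ae (Filter.Eventually.of_forall hpt)]
  rw [integral_finsetSum _ fun σ _ => h_integrable σ]
  simp only [hcomp, Finset.sum_const, Finset.card_univ, Fintype.card_perm, Fintype.card_fin,
    nsmul_eq_mul]

open Polynomial in
lemma prod_prod_Ioi_sub_eq_det_oddHermite {p : ℕ} (v : Fin p → ℝ) :
    ∏ i, ∏ j ∈ Finset.Ioi i, (v j - v i) =
      (Matrix.of fun i j : Fin p => (oddHermite i).eval (v j)).det := by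
  rw [← Matrix.det_vandermonde, Matrix.det_eval_matrixOfPolynomials_eq_det_vandermonde v
    (fun i => oddHermite i) (fun i => (oddHermite_monic_natDegree i).2)
    (fun i => (oddHermite_monic_natDegree i).1), ← Matrix.det_transpose]
  rfl

open Polynomial in
lemma prod_sub_mul_vandermonde {p : ℕ} (v : Fin p → ℝ) (z : ℝ) :
    (∏ i, (v i - z)) * ∏ i, ∏ j ∈ Finset.Ioi i, (v j - v i) =
      ∑ l : Fin (p + 1), (-1) ^ (l : ℕ) * (oddHermite l).eval z *
        (Matrix.of fun i j : Fin p => (oddHermite (l.succAbove i)).eval (v j)).det := by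
  have h := prod_prod_Ioi_sub_eq_det_oddHermite (Fin.cons z v : Fin (p + 1) → ℝ)
  rw [Fin.prod_univ_succ, Fin.prod_Ioi_zero] at h
  simp only [Fin.prod_Ioi_succ, Fin.cons_zero, Fin.cons_succ] at h
  rw [h, ← Matrix.det_transpose, Matrix.det_succ_row_zero]
  refine Finset.sum_congr rfl fun l _ => ?_
  rw [← Matrix.det_transpose (Matrix.of fun i j : Fin p => (oddHermite (l.succAbove i)).eval (v j))]
  rfl

open Polynomial in
/-- The averaged characteristic polynomial of the Laguerre ensemble is the orthogonal polynomial. -/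
lemma integral_prod_sub_mul_vandermonde_sq (p : ℕ) (z : ℝ) :
    ∫ x : Fin p → ℝ, (∏ i, (x i ^ 2 - z)) * (∏ i, ∏ j ∈ Finset.Ioi i, (x j ^ 2 - x i ^ 2) ^ 2) *
        ∏ i, (x i ^ 2 * halfGaussian (x i)) =
      (-1) ^ p * (oddHermite p).eval z *
        (p.factorial * ∏ j : Fin p, ((2 * (j : ℕ) + 1).factorial * √(2 * Real.pi) / 2)) := by
  have h_integrable : ∀ m n : ℕ, Integrable fun x : ℝ =>
      (oddHermite m).eval (x ^ 2) * (oddHermite n).eval (x ^ 2) * (x ^ 2 * halfGaussian x) := by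
    intro m n
    refine (integrable_polynomial_mul_halfGaussian
      ((oddHermite m).comp (X ^ 2) * (oddHermite n).comp (X ^ 2) * X ^ 2)).congr
      (Filter.Eventually.of_forall fun x => ?_)
    simp [mul_assoc]
  have hA := fun l : Fin (p + 1) => integral_det_mul_det (p := p)
    (fun i x => (oddHermite (l.succAbove i)).eval (x ^ 2))
    (fun i x => (oddHermite i).eval (x ^ 2)) (fun x => x ^ 2 * halfGaussian x)
    (fun i j => h_integrable _ _)
  have hpt : ∀ x : Fin p → ℝ,
      (∏ i, (x i ^ 2 - z)) * (∏ i, ∏ j ∈ Finset.Ioi i, (x j ^ 2 - x i ^ 2) ^ 2) *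
        ∏ i, (x i ^ 2 * halfGaussian (x i)) =
      ∑ l : Fin (p + 1), (-1) ^ (l : ℕ) * (oddHermite l).eval z *
        ((Matrix.of fun i j : Fin p => (oddHermite (l.succAbove i)).eval (x j ^ 2)).det *
          (Matrix.of fun i j : Fin p => (oddHermite i).eval (x j ^ 2)).det *
          ∏ i, (x i ^ 2 * halfGaussian (x i))) := by
    intro x
    simp only [Finset.prod_pow]
    rw [pow_two (∏ i, ∏ j ∈ Finset.Ioi i, (x j ^ 2 - x i ^ 2)), ← mul_assoc,
      prod_sub_mul_vandermonde (fun i => x i ^ 2) z,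
      prod_prod_Ioi_sub_eq_det_oddHermite (fun i => x i ^ 2), Finset.sum_mul, Finset.sum_mul]
    refine Finset.sum_congr rfl fun l _ => ?_
    simp only [mul_assoc]
  simp only [hpt]
  rw [integral_finsetSum _ fun l _ => (hA l).1.const_mul _]
  simp only [integral_const_mul, (hA _).2, integral_oddHermite_mul_oddHermite]
  rw [Finset.sum_eq_single (Fin.last p)]
  · have hd : (Matrix.of fun i j : Fin p =>
        if (((Fin.last p).succAbove i : Fin (p + 1)) : ℕ) = (j : ℕ) then
          ((2 * (j : ℕ) + 1).factorial : ℝ) * √(2 * Real.pi) / 2 else 0) =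
        Matrix.diagonal fun j : Fin p => ((2 * (j : ℕ) + 1).factorial : ℝ) * √(2 * Real.pi) / 2 := by
      ext i j
      by_cases h : i = j
      · simp [h]
      · simp [h, Fin.val_inj]
    rw [hd, Matrix.det_diagonal, Fin.val_last]
  · intro l _ hl
    obtain ⟨i, hi⟩ := Fin.exists_succAbove_eq (Ne.symm hl)
    rw [Matrix.det_eq_zero_of_row_eq_zero i]
    · simp
    · intro j
      simp [hi, j.isLt.ne']
  · simp

/-- The elementary symmetric polynomial of the squares against the unnormalized density. -/
noncomputable def esymmLaguerre (p k : ℕ) (x : Fin p → ℝ) : ℝ :=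
  (∑ S ∈ Finset.powersetCard k (Finset.univ : Finset (Fin p)), ∏ i ∈ S, (x i) ^ 2) *
    (∏ i, ∏ j ∈ Finset.Ioi i, (x j ^ 2 - x i ^ 2) ^ 2) * ∏ i, (x i ^ 2 * halfGaussian (x i))

lemma integrable_mvPolynomial_mul_halfGaussian {p : ℕ} (P : MvPolynomial (Fin p) ℝ) :
    Integrable fun x : Fin p → ℝ => MvPolynomial.eval x P * ∏ i, halfGaussian (x i) := by
  induction P using MvPolynomial.induction_on' with
  | monomial m a =>
    have h := Integrable.fintype_prod (μ := fun _ : Fin p => (volume : Measure ℝ))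
      (f := fun i y => y ^ (m i) * halfGaussian y) fun i => by
        simpa using integrable_polynomial_mul_halfGaussian (Polynomial.X ^ (m i))
    refine (h.const_mul a).congr (Filter.Eventually.of_forall fun x => ?_)
    simp only [MvPolynomial.eval_monomial, Finset.prod_mul_distrib, mul_assoc]
    rw [Finsupp.prod_fintype _ _ fun i => pow_zero _]
  | add P Q hP hQ =>
    exact (hP.add hQ).congr (Filter.Eventually.of_forall fun x => by simp [add_mul])

lemma integrable_esymmLaguerre (p k : ℕ) : Integrable (esymmLaguerre p k) := by
  refine (integrable_mvPolynomial_mul_halfGaussian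
    ((∑ S ∈ Finset.powersetCard k (Finset.univ : Finset (Fin p)),
      ∏ i ∈ S, (MvPolynomial.X i) ^ 2) *
    (∏ i, ∏ j ∈ Finset.Ioi i, (MvPolynomial.X j ^ 2 - MvPolynomial.X i ^ 2) ^ 2) *
    ∏ i, MvPolynomial.X i ^ 2)).congr (Filter.Eventually.of_forall fun x => ?_)
  simp only [esymmLaguerre, map_mul, map_sum, map_prod, map_pow, map_sub, MvPolynomial.eval_X,
    Finset.prod_mul_distrib, mul_assoc]

lemma doubleFactorial_mul_choose {p k : ℕ} (hkp : k ≤ p) :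
    ((Nat.doubleFactorial (2 * k - 1) : ℝ)) * ((2 * p + 1).choose (2 * (p - k) + 1) : ℝ) =
      (Nat.factorial (2 * p + 1) : ℝ)
          / ((Nat.factorial (2 * p + 1 - 2 * k) : ℝ) * 2 ^ k * (Nat.factorial k : ℝ)) := by
  have hdf : ∀ k : ℕ, (2 * k).factorial =
      Nat.doubleFactorial (2 * k - 1) * (2 ^ k * k.factorial) := by
    intro k
    rcases k with _ | k
    · simp
    · rw [← Nat.doubleFactorial_two_mul, show 2 * (k + 1) = 2 * k + 1 + 1 by ring,
        Nat.factorial_eq_mul_doubleFactorial, mul_comm]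
      rfl
  have hc := Nat.choose_mul_factorial_mul_factorial
    (show 2 * (p - k) + 1 ≤ 2 * p + 1 by omega)
  rw [show 2 * p + 1 - (2 * (p - k) + 1) = 2 * k by omega, hdf] at hc
  rw [show 2 * p + 1 - 2 * k = 2 * (p - k) + 1 by omega, ← hc, eq_div_iff (by positivity)]
  push_cast
  ring

open Polynomial in
lemma integral_esymmLaguerre {p k : ℕ} (hkp : k ≤ p) :
    ∫ x, esymmLaguerre p k x =
      (Nat.factorial (2 * p + 1) : ℝ)
          / ((Nat.factorial (2 * p + 1 - 2 * k) : ℝ) * 2 ^ k * (Nat.factorial k : ℝ)) *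
        (p.factorial * ∏ j : Fin p, ((2 * (j : ℕ) + 1).factorial * √(2 * Real.pi) / 2)) := by
  set c : ℝ := p.factorial * ∏ j : Fin p, ((2 * (j : ℕ) + 1).factorial * √(2 * Real.pi) / 2)
    with hc
  have hpoly : ∑ m ∈ Finset.range (p + 1),
      C ((-1) ^ (p - m) * ∫ x, esymmLaguerre p m x) * X ^ (p - m) =
        C ((-1) ^ p * c) * oddHermite p := by
    refine Polynomial.funext fun z => ?_
    have hz := integral_prod_sub_mul_vandermonde_sq p z
    have hpt : ∀ x : Fin p → ℝ,
        (∏ i, (x i ^ 2 - z)) * (∏ i, ∏ j ∈ Finset.Ioi i, (x j ^ 2 - x i ^ 2) ^ 2) *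
          ∏ i, (x i ^ 2 * halfGaussian (x i)) =
        ∑ m ∈ Finset.range (p + 1), (-z) ^ (p - m) * esymmLaguerre p m x := by
      intro x
      simp only [sub_eq_add_neg _ z, Finset.prod_add]
      rw [Finset.sum_powerset, Finset.sum_mul, Finset.sum_mul, Finset.card_univ, Fintype.card_fin]
      refine Finset.sum_congr rfl fun m _ => ?_
      rw [esymmLaguerre, ← mul_assoc, ← mul_assoc, Finset.mul_sum]
      congr 2
      refine Finset.sum_congr rfl fun S hS => ?_
      rw [Finset.mem_powersetCard] at hS
      rw [Finset.prod_const, Finset.card_sdiff_of_subset hS.1, hS.2, Finset.card_univ,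
        Fintype.card_fin, mul_comm]
    simp only [hpt] at hz
    rw [integral_finsetSum _ fun m _ => (integrable_esymmLaguerre p m).const_mul _] at hz
    simp only [integral_const_mul] at hz
    simp only [eval_finsetSum, eval_mul, eval_C, eval_pow, eval_X]
    rw [mul_right_comm, ← hz]
    refine Finset.sum_congr rfl fun m _ => ?_
    rw [neg_pow z]
    ring
  have hco := congrArg (fun q => coeff q (p - k)) hpoly
  simp only [finsetSum_coeff, coeff_C_mul, coeff_X_pow, mul_ite, mul_one, mul_zero] at hco
  rw [Finset.sum_eq_single k, if_pos rfl, coeff_oddHermite,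
    show hermite (2 * p + 1) = hermite (2 * k + (2 * (p - k) + 1)) by congr 1; omega,
    coeff_hermite_explicit, show 2 * k + (2 * (p - k) + 1) = 2 * p + 1 by omega] at hco
  · rw [← doubleFactorial_mul_choose hkp]
    push_cast at hco
    have h1 : ((-1 : ℝ)) ^ p = (-1) ^ (p - k) * (-1) ^ k := by rw [← pow_add]; congr 1; omega
    have h2 : ((-1 : ℝ)) ^ k * (-1) ^ k = 1 := by rw [← mul_pow]; simp
    have h3 : ((-1 : ℝ)) ^ (p - k) ≠ 0 := by simp
    refine mul_left_cancel₀ h3 ?_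
    rw [hco, h1]
    linear_combination ((-1 : ℝ)) ^ (p - k) * c * (Nat.doubleFactorial (2 * k - 1) : ℝ) *
      ((2 * p + 1).choose (2 * (p - k) + 1) : ℝ) * h2
  · intro m hm hmk
    rw [Finset.mem_range] at hm
    exact if_neg (by omega)
  · intro h
    exact absurd (Finset.mem_range.mpr (by omega)) h

lemma prod_range_sub_mul_add_mul_factorial {m j : ℕ} (h : m ≤ j) :
    (∏ i ∈ Finset.range m, (((j : ℝ) - i) * ((j : ℝ) + i + 1))) * ((j - m).factorial : ℝ) =
      ((j + m).factorial : ℝ) := by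
  induction m with
  | zero => simp
  | succ m ih =>
    have h1 : (j - m).factorial = (j - m) * (j - (m + 1)).factorial := by
      rw [show j - m = (j - (m + 1)) + 1 by omega, Nat.factorial_succ]
    have h2 := ih (by omega)
    rw [h1] at h2
    push_cast [Nat.cast_sub (show m ≤ j by omega)] at h2
    rw [Finset.prod_range_succ, ← add_assoc, Nat.factorial_succ, Nat.cast_mul, ← h2]
    push_cast
    ring

lemma prod_prod_Ioi_sub_mul_add (p : ℕ) :
    (∏ i : Fin p, ∏ j ∈ Finset.Ioi i, ((((j : ℕ) : ℝ) - ((i : ℕ) : ℝ)) *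
        (((j : ℕ) : ℝ) + ((i : ℕ) : ℝ) + 1))) = ∏ j : Fin p, ((2 * (j : ℕ)).factorial : ℝ) := by
  rw [Finset.prod_comm' (t' := Finset.univ) (s' := fun j => Finset.Iio j) (by simp)]
  refine Finset.prod_congr rfl fun j _ => ?_
  have h := prod_range_sub_mul_add_mul_factorial (le_refl (j : ℕ))
  rw [Nat.sub_self, Nat.factorial_zero, Nat.cast_one, mul_one, ← two_mul] at h
  rw [← h, ← Nat.Iio_eq_range, ← Fin.map_valEmbedding_Iio, Finset.prod_map]
  rfl

lemma prod_even_factorial_mul (p : ℕ) :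
    (∏ j : Fin p, ((2 * (j : ℕ)).factorial : ℝ)) * ((2 * p).factorial : ℝ) =
      (∏ j : Fin p, ((2 * (j : ℕ) + 1).factorial : ℝ)) * (2 ^ p * (p.factorial : ℝ)) := by
  induction p with
  | zero => simp
  | succ p ih =>
    rw [Fin.prod_univ_castSucc, Fin.prod_univ_castSucc]
    simp only [Fin.val_castSucc, Fin.val_last]
    rw [ih, show 2 * (p + 1) = 2 * p + 1 + 1 by ring, Nat.factorial_succ (2 * p + 1),
      Nat.factorial_succ p]
    push_cast
    ring

lemma cW_mul_prod (p : ℕ) :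
    cW p * ∏ j : Fin p, (((2 * (j : ℕ) + 1).factorial : ℝ) * √(2 * Real.pi) / 2) = 1 := by
  have hsqrt : (√(2 * Real.pi)) ^ p = 2 ^ ((p : ℝ) / 2) * Real.pi ^ ((p : ℝ) / 2) := by
    rw [← Real.mul_rpow (by norm_num) Real.pi_pos.le, Real.sqrt_eq_rpow, ← Real.rpow_natCast,
      ← Real.rpow_mul (by positivity)]
    congr 1
    ring
  have htwo : (2 : ℝ) ^ ((3 * (p : ℝ)) / 2) * 2 ^ ((p : ℝ) / 2) = 2 ^ p * 2 ^ p := by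
    rw [← Real.rpow_add (by norm_num), ← pow_add, ← Real.rpow_natCast]
    congr 1
    push_cast
    ring
  have hpi : Real.pi ^ ((p : ℝ) / 2) ≠ 0 := (Real.rpow_pos_of_pos Real.pi_pos _).ne'
  have hfac := prod_even_factorial_mul p
  have hne : ∏ j : Fin p, ((2 * (j : ℕ)).factorial : ℝ) ≠ 0 :=
    Finset.prod_ne_zero_iff.mpr fun j _ => by positivity
  have hne' : ((2 * p).factorial : ℝ) ≠ 0 := by positivity
  rw [cW, prod_prod_Ioi_sub_mul_add, Finset.prod_div_distrib, Finset.prod_mul_distrib,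
    Finset.prod_const, Finset.prod_const, Finset.card_univ, Fintype.card_fin, hsqrt,
    div_mul_div_comm, div_eq_one_iff_eq (by positivity)]
  linear_combination (Real.pi ^ ((p : ℝ) / 2) * p.factorial *
    ∏ j : Fin p, ((2 * (j : ℕ) + 1).factorial : ℝ)) * htwo -
    (Real.pi ^ ((p : ℝ) / 2) * 2 ^ p) * hfac

lemma prod_prod_Ioi_const_sq_mul (p : ℕ) (c : ℝ) :
    (∏ i : Fin p, ∏ _j ∈ Finset.Ioi i, c ^ 2) * c ^ p = c ^ (p ^ 2) := by
  induction p with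
  | zero => simp
  | succ p ih =>
    rw [Fin.prod_univ_succ, Fin.prod_Ioi_zero]
    simp only [Fin.prod_Ioi_succ]
    rw [Finset.prod_const, Finset.card_univ, Fintype.card_fin,
      show c ^ (p + 1) ^ 2 = c ^ p ^ 2 * c ^ (2 * p) * c by ring, ← ih]
    ring

open Classical in
/-- After rescaling by `√(t (1 - t))` the integrand no longer depends on `t`. -/
lemma esymm_mul_fW_smul (p k : ℕ) {t : ℝ} (ht0 : 0 < t) (ht1 : t < 1) (x : Fin p → ℝ) :
    (∑ S ∈ Finset.powersetCard k (Finset.univ : Finset (Fin p)),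
        ∏ i ∈ S, ((√(t * (1 - t)) • x) i) ^ 2) * fW p t (√(t * (1 - t)) • x) =
      ((t * (1 - t)) ^ k * cW p * ((t * (1 - t)) ^ (-(((p : ℝ) ^ 2) + (p : ℝ) / 2)) *
        (t * (1 - t)) ^ (p ^ 2))) * if Monotone x then esymmLaguerre p k x else 0 := by
  have hs : 0 < t * (1 - t) := mul_pos ht0 (by linarith)
  rw [fW, show 2 * t * (1 - t) = 2 * (t * (1 - t)) by ring]
  set s := t * (1 - t)
  have hr : 0 < √s := Real.sqrt_pos.mpr hs
  simp only [Pi.smul_apply, smul_eq_mul, mul_pow, Real.sq_sqrt hs.le, mul_nonneg_iff_of_pos_left hr,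
    mul_le_mul_iff_right₀ hr]
  by_cases hm : Monotone x
  · rw [if_pos hm]
    by_cases h0 : ∀ i, 0 ≤ x i
    · rw [if_pos ⟨h0, fun i j h => hm h⟩, esymmLaguerre]
      simp only [← mul_sub, mul_pow, Finset.prod_mul_distrib, ← Finset.mul_sum]
      have hexp : Real.exp (-(s * ∑ i, x i ^ 2) / (2 * s)) = ∏ i, halfGaussian (x i) := by
        simp only [halfGaussian, h0, if_true]
        rw [← Real.exp_sum, ← Finset.sum_div, Finset.sum_neg_distrib]
        congr 1
        field_simp
      have hsum : ∑ S ∈ Finset.powersetCard k (Finset.univ : Finset (Fin p)),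
          (∏ _i ∈ S, s) * ∏ i ∈ S, x i ^ 2 = s ^ k *
          ∑ S ∈ Finset.powersetCard k (Finset.univ : Finset (Fin p)), ∏ i ∈ S, x i ^ 2 := by
        rw [Finset.mul_sum]
        refine Finset.sum_congr rfl fun S hS => ?_
        rw [Finset.prod_const, (Finset.mem_powersetCard.mp hS).2]
      rw [hexp, hsum, ← prod_prod_Ioi_const_sq_mul, Finset.prod_const (s := Finset.univ) s,
        Finset.card_univ, Fintype.card_fin]
      ring
    · rw [if_neg fun h => h0 h.1]
      push Not at h0
      obtain ⟨i, hi⟩ := h0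
      have hz : ∏ i, (x i ^ 2 * halfGaussian (x i)) = 0 :=
        Finset.prod_eq_zero (Finset.mem_univ i) (by rw [halfGaussian, if_neg hi.not_ge, mul_zero])
      rw [esymmLaguerre, hz]
      simp
  · rw [if_neg hm, if_neg fun h => hm fun i j hij => h.2 i j hij]
    simp

lemma esymmLaguerre_comp_perm {p : ℕ} (k : ℕ) (σ : Equiv.Perm (Fin p)) (x : Fin p → ℝ) :
    esymmLaguerre p k (x ∘ σ) = esymmLaguerre p k x := by
  have hV : ∀ y : Fin p → ℝ, ∏ i, ∏ j ∈ Finset.Ioi i, (y j ^ 2 - y i ^ 2) ^ 2 =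
      (Matrix.vandermonde fun i => y i ^ 2).det ^ 2 := by
    intro y
    simp only [Matrix.det_vandermonde, Finset.prod_pow]
  have hσ : (Matrix.vandermonde fun i => (x ∘ σ) i ^ 2).det ^ 2 =
      (Matrix.vandermonde fun i => x i ^ 2).det ^ 2 := by
    have h := Matrix.det_permute σ (Matrix.vandermonde fun i => x i ^ 2)
    have h' : (Matrix.vandermonde fun i => (x ∘ σ) i ^ 2) =
        (Matrix.vandermonde fun i => x i ^ 2).submatrix σ id := rfl
    have hsq : ((Equiv.Perm.sign σ : ℤ) : ℝ) ^ 2 = 1 := by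
      rw [pow_two, ← Int.cast_mul, Int.units_coe_mul_self, Int.cast_one]
    rw [h', h, mul_pow, hsq, one_mul]
  have he : ∑ S ∈ Finset.powersetCard k (Finset.univ : Finset (Fin p)), ∏ i ∈ S, (x ∘ σ) i ^ 2 =
      ∑ S ∈ Finset.powersetCard k (Finset.univ : Finset (Fin p)), ∏ i ∈ S, x i ^ 2 := by
    refine Finset.sum_equiv (Equiv.finsetCongr σ) (fun S => ?_) fun S _ => ?_
    · simp [Finset.mem_powersetCard]
    · simp [Finset.prod_map]
  rw [esymmLaguerre, esymmLaguerre, hV, hV, hσ, he]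
  congr 1
  exact Equiv.prod_comp σ fun i => x i ^ 2 * halfGaussian (x i)

lemma esymmLaguerre_eq_zero {p : ℕ} (k : ℕ) (x : Fin p → ℝ) (hx : ¬ Function.Injective x) :
    esymmLaguerre p k x = 0 := by
  have hV : ∏ i, ∏ j ∈ Finset.Ioi i, (x j ^ 2 - x i ^ 2) ^ 2 = 0 := by
    have h := Matrix.det_vandermonde fun i => x i ^ 2
    simp only [Finset.prod_pow, ← h]
    rw [sq_eq_zero_iff, Matrix.det_vandermonde_eq_zero_iff]
    simp only [Function.Injective, not_forall] at hx
    obtain ⟨i, j, hij, hne⟩ := hx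
    exact ⟨i, j, by rw [hij], hne⟩
  rw [esymmLaguerre, hV, mul_zero, zero_mul]

/-- expectation of the `k`-th elementary symmetric polynomial of
the squared branch positions of the continuous `p`-watermelon with wall
condition at time `t`. -/
theorem melonW_esymm_sq_expectation (p k : ℕ) (hp : 1 ≤ p) (hk1 : 1 ≤ k) (hkp : k ≤ p)
    (t : ℝ) (ht0 : 0 < t) (ht1 : t < 1) :
    (∫ x : Fin p → ℝ,
        (∑ S ∈ Finset.powersetCard k (Finset.univ : Finset (Fin p)),
          ∏ i ∈ S, (x i) ^ 2) * fW p t x)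
      = (Nat.factorial (2 * p + 1) : ℝ)
          / ((Nat.factorial (2 * p + 1 - 2 * k) : ℝ) * 2 ^ k * (Nat.factorial k : ℝ))
        * (t * (1 - t)) ^ k := by
  classical
  have hs : 0 < t * (1 - t) := mul_pos ht0 (by linarith)
  have hr : 0 < √(t * (1 - t)) := Real.sqrt_pos.mpr hs
  have hscale := Measure.integral_comp_smul (volume : Measure (Fin p → ℝ))
    (fun x => (∑ S ∈ Finset.powersetCard k (Finset.univ : Finset (Fin p)),
      ∏ i ∈ S, (x i) ^ 2) * fW p t x) √(t * (1 - t))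
  simp only [esymm_mul_fW_smul p k ht0 ht1] at hscale
  rw [integral_const_mul, abs_of_pos (by positivity), Module.finrank_fin_fun, smul_eq_mul,
    eq_inv_mul_iff_mul_eq₀ (by positivity)] at hscale
  have hmono := factorial_mul_integral_monotone (esymmLaguerre p k) (integrable_esymmLaguerre p k)
    (esymmLaguerre_comp_perm k) (esymmLaguerre_eq_zero k)
  rw [integral_esymmLaguerre hkp, mul_left_comm] at hmono
  replace hmono := mul_left_cancel₀ (by positivity : (p.factorial : ℝ) ≠ 0) hmono
  have hpow : √(t * (1 - t)) ^ p * ((t * (1 - t)) ^ (-(((p : ℝ) ^ 2) + (p : ℝ) / 2)) *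
      (t * (1 - t)) ^ (p ^ 2)) = 1 := by
    rw [Real.sqrt_eq_rpow, ← Real.rpow_natCast _ p, ← Real.rpow_natCast _ (p ^ 2),
      ← Real.rpow_mul hs.le, ← Real.rpow_add hs, ← Real.rpow_add hs]
    convert! Real.rpow_zero (t * (1 - t)) using 2
    push_cast
    ring
  rw [← hscale, hmono]
  set R := (Nat.factorial (2 * p + 1) : ℝ)
    / ((Nat.factorial (2 * p + 1 - 2 * k) : ℝ) * 2 ^ k * (Nat.factorial k : ℝ))
  linear_combination ((t * (1 - t)) ^ k * R * cW p *
    ∏ j : Fin p, (((2 * (j : ℕ) + 1).factorial : ℝ) * √(2 * Real.pi) / 2)) * hpow +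
    ((t * (1 - t)) ^ k * R) * cW_mul_prod p
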